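/- (No global binary valuation, Kochen–Specker-type consequence of Gleason's theorem.) Let n ≥ 3. There is no function f from the orthogonal projections of ℂ^n to {0, 1} ⊆ ℝ such that f(1) = 1 for the identity matrix and f(P + Q) = f(P) + f(Q) whenever P and Q are orthogonal projections with P * Q = 0. Hence a Global Binary Valuation of the graph of powers satisfying the additivity condition of an Intensive State of Affairs is impossible. -/

import Mathlib

open Matrix

/-- A `{0, 1}`-valued function on orthogonal projections, additive on orthogonal pairs. -/
structure IsBinaryValuation {ι : Type*} [Fintype ι] (f : Matrix ι ι ℂ → ℝ) : Prop where
  binary : ∀ P : Matrix ι ι ℂ, Pᴴ = P → P * P = P → f P = 0 ∨ f P = 1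
  additive : ∀ P Q : Matrix ι ι ℂ, Pᴴ = P → P * P = P → Qᴴ = Q → Q * Q = Q → P * Q = 0 →
    f (P + Q) = f P + f Q

theorem mul_eq_zero_symm_of_conjTranspose_eq {ι : Type*} [Fintype ι] {P Q : Matrix ι ι ℂ}
    (hP : Pᴴ = P) (hQ : Qᴴ = Q) (h : P * Q = 0) : Q * P = 0 := by
  simpa [conjTranspose_mul, hP, hQ] using congrArg conjTranspose h

theorem isIdempotent_add_of_mul_eq_zero {ι : Type*} [Fintype ι] {P Q : Matrix ι ι ℂ}
    (hP : Pᴴ = P) (hP2 : P * P = P) (hQ : Qᴴ = Q) (hQ2 : Q * Q = Q) (h : P * Q = 0) :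
    (P + Q) * (P + Q) = P + Q := by
  simp [add_mul, mul_add, hP2, hQ2, h, mul_eq_zero_symm_of_conjTranspose_eq hP hQ h]

namespace IsBinaryValuation

variable {ι κ : Type*} [Fintype ι] [Fintype κ] {f : Matrix ι ι ℂ → ℝ}

theorem map_zero (hf : IsBinaryValuation f) : f 0 = 0 := by
  simpa using hf.additive 0 0 (by simp) (by simp) (by simp) (by simp) (by simp)

theorem add_le_one (hf : IsBinaryValuation f) {P Q : Matrix ι ι ℂ} (hP : Pᴴ = P)
    (hP2 : P * P = P) (hQ : Qᴴ = Q) (hQ2 : Q * Q = Q) (h : P * Q = 0) : f P + f Q ≤ 1 := by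
  rw [← hf.additive P Q hP hP2 hQ hQ2 h]
  rcases hf.binary (P + Q) (by simp [hP, hQ])
    (isIdempotent_add_of_mul_eq_zero hP hP2 hQ hQ2 h) with h' | h' <;> simp [h']

/-- Pull back a valuation along the compression `A ↦ E A Eᴴ` by an isometry `E`. -/
theorem comp_isometry [DecidableEq κ] (hf : IsBinaryValuation f) {E : Matrix ι κ ℂ}
    (hE : Eᴴ * E = 1) : IsBinaryValuation fun A : Matrix κ κ ℂ => f (E * A * Eᴴ) := by
  have hmul (A B : Matrix κ κ ℂ) : E * A * Eᴴ * (E * B * Eᴴ) = E * (A * B) * Eᴴ := by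
    calc E * A * Eᴴ * (E * B * Eᴴ) = E * A * (Eᴴ * E) * B * Eᴴ := by simp only [Matrix.mul_assoc]
      _ = E * (A * B) * Eᴴ := by simp [hE, Matrix.mul_assoc]
  have hstar {A : Matrix κ κ ℂ} (hA : Aᴴ = A) : (E * A * Eᴴ)ᴴ = E * A * Eᴴ := by
    simp [conjTranspose_mul, hA, Matrix.mul_assoc]
  refine ⟨fun P hP hP2 => hf.binary _ (hstar hP) (by rw [hmul, hP2]),
    fun P Q hP hP2 hQ hQ2 h => ?_⟩
  rw [Matrix.mul_add, Matrix.add_mul]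
  exact hf.additive _ _ (hstar hP) (by rw [hmul, hP2]) (hstar hQ) (by rw [hmul, hQ2])
    (by simp [hmul, h])

/-- A normalized valuation takes the value `1` on some diagonal matrix unit. -/
theorem exists_single_eq_one [DecidableEq ι] (hf : IsBinaryValuation f) (h1 : f 1 = 1) :
    ∃ i, f (single i i 1) = 1 := by
  by_contra! hne
  have h0 (i : ι) : f (single i i 1) = 0 :=
    (hf.binary _ (by simp) (by simp)).resolve_right (hne i)
  have hsum (s : Finset ι) : f (diagonal fun i => if i ∈ s then 1 else 0) = 0 := by
    induction s using Finset.induction_on with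
    | empty => simpa using hf.map_zero
    | insert a s ha ih =>
      have hdec : (diagonal fun i => if i ∈ insert a s then (1 : ℂ) else 0) =
          single a a 1 + diagonal fun i => if i ∈ s then 1 else 0 := by
        rw [← diagonal_single, diagonal_add]
        congr 1
        funext i
        by_cases hi : i = a
        · simp [hi, ha]
        · simp [hi]
      rw [hdec, hf.additive, h0, ih, add_zero]
      · simp
      · simp
      · rw [diagonal_conjTranspose]
        congr 1
        funext i
        simp [apply_ite]
      · simp
      · rw [← diagonal_single, diagonal_mul_diagonal, ← diagonal_zero]
        congr 1
        funext i
        by_cases hi : i = a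
        · simp [hi, ha]
        · simp [hi]
  have := hsum Finset.univ
  simp [h1] at this

end IsBinaryValuation

/-- The orthogonal projection of `ℂ³` onto the line spanned by an integer vector. -/
noncomputable def rayProj (v : Fin 3 → ℤ) : Matrix (Fin 3) (Fin 3) ℂ :=
  ((v ⬝ᵥ v : ℤ) : ℂ)⁻¹ • vecMulVec (fun i => (v i : ℂ)) fun i => (v i : ℂ)

theorem rayProj_conjTranspose (v : Fin 3 → ℤ) : (rayProj v)ᴴ = rayProj v := by
  ext i j
  simp [rayProj, vecMulVec_apply, mul_comm]

theorem rayProj_mul_self (v : Fin 3 → ℤ) : rayProj v * rayProj v = rayProj v := by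
  have hd : (fun i => (v i : ℂ)) ⬝ᵥ (fun i => (v i : ℂ)) = ((v ⬝ᵥ v : ℤ) : ℂ) := by
    simp [dotProduct]
  rw [rayProj, smul_mul_smul_comm, vecMulVec_mul_vecMulVec, hd, vecMulVec_smul, smul_smul]
  congr 1
  rcases eq_or_ne ((v ⬝ᵥ v : ℤ) : ℂ) 0 with h | h
  · simp [h]
  · field_simp

theorem rayProj_mul_of_orthogonal {u v : Fin 3 → ℤ} (h : u ⬝ᵥ v = 0) :
    rayProj u * rayProj v = 0 := by
  have hd : (fun i => (u i : ℂ)) ⬝ᵥ (fun i => (v i : ℂ)) = 0 := by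
    simpa [dotProduct] using congrArg (Int.cast : ℤ → ℂ) h
  rw [rayProj, rayProj, smul_mul_smul_comm, vecMulVec_mul_vecMulVec, hd]
  simp

theorem rayProj_single_zero : rayProj ![1, 0, 0] = single 0 0 1 := by
  ext i j
  fin_cases i <;> fin_cases j <;> simp [rayProj, vecMulVec_apply, single]

/-- The projections onto the lines of an orthogonal basis sum to the identity. -/
theorem sum_rayProj_eq_one {b : Fin 3 → Fin 3 → ℤ} (h0 : ∀ k, b k ⬝ᵥ b k ≠ 0)
    (h : ∀ k l, k ≠ l → b k ⬝ᵥ b l = 0) : ∑ k, rayProj (b k) = 1 := by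
  let A : Matrix (Fin 3) (Fin 3) ℂ := of fun k i => (b k i : ℂ)
  let D : Matrix (Fin 3) (Fin 3) ℂ := diagonal fun k => ((b k ⬝ᵥ b k : ℤ) : ℂ)⁻¹
  have hA (k l) : (A * Aᵀ) k l = ((b k ⬝ᵥ b l : ℤ) : ℂ) := by
    simp [A, mul_apply, dotProduct]
  have h1 : A * (Aᵀ * D) = 1 := by
    rw [← Matrix.mul_assoc]
    ext k l
    rw [mul_diagonal, hA]
    rcases eq_or_ne k l with rfl | hkl
    · rw [one_apply_eq, mul_inv_cancel₀ (by exact_mod_cast h0 k)]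
    · simp [h k l hkl, one_apply_ne hkl]
  rw [← mul_eq_one_comm.mp h1]
  ext i j
  simp only [mul_apply (M := Aᵀ * D), D, mul_diagonal, Matrix.sum_apply]
  refine Finset.sum_congr rfl fun k _ => ?_
  simp only [rayProj, A, Matrix.smul_apply, vecMulVec_apply, transpose_apply, of_apply, smul_eq_mul]
  ring

section Colouring

variable {g : (Fin 3 → ℤ) → Prop}

/-- In an orthogonality-respecting colouring of integer rays, the ray `(1, 0, 0)` being
selected forces both `(1, 0, 1)` and `(1, 0, -1)` to be selected. -/
theorem ray_colouring_forces (hpair : ∀ u v, u ⬝ᵥ v = 0 → g u → ¬ g v)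
    (hbasis : ∀ b : Fin 3 → Fin 3 → ℤ, (∀ k, b k ⬝ᵥ b k ≠ 0) →
      (∀ k l, k ≠ l → b k ⬝ᵥ b l = 0) → ∃ k, g (b k))
    (hg : g ![1, 0, 0]) {s : ℤ} (hs : s = 1 ∨ s = -1) : g ![1, 0, s] := by
  have hthird (u v w : Fin 3 → ℤ)
      (hn : u ⬝ᵥ u ≠ 0 ∧ v ⬝ᵥ v ≠ 0 ∧ w ⬝ᵥ w ≠ 0)
      (ho : u ⬝ᵥ v = 0 ∧ u ⬝ᵥ w = 0 ∧ v ⬝ᵥ w = 0) (hu : ¬ g u) (hv : ¬ g v) : g w := by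
    obtain ⟨hn0, hn1, hn2⟩ := hn
    obtain ⟨h01, h02, h12⟩ := ho
    obtain ⟨k, hk⟩ := hbasis ![u, v, w]
      (by intro k; fin_cases k <;> assumption)
      (by
        intro k l hkl
        fin_cases k <;> fin_cases l <;>
          first
          | exact absurd rfl hkl
          | assumption
          | (rw [dotProduct_comm]; assumption))
    fin_cases k
    · exact absurd hk hu
    · exact absurd hk hv
    · exact hk
  have hy : ¬ g ![0, 1, 0] := hpair _ _ (by decide) hg
  have hz : ¬ g ![0, 0, 1] := hpair _ _ (by decide) hg
  by_cases hxy : g ![1, -1, 0]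
  · have hyz := hpair ![1, 0, 0] ![0, 1, s] (by rcases hs with rfl | rfl <;> decide) hg
    have hoct := hpair ![1, -1, 0] ![1, 1, -s] (by rcases hs with rfl | rfl <;> decide) hxy
    have htwo_neg := hthird _ _ ![2, -1, s] (by rcases hs with rfl | rfl <;> decide)
      (by rcases hs with rfl | rfl <;> decide) hyz hoct
    have hsteep := hpair _ ![1, 0, -2 * s] (by rcases hs with rfl | rfl <;> decide) htwo_neg
    have hshallow := hthird ![0, 1, 0] _ ![2, 0, s] (by rcases hs with rfl | rfl <;> decide)
      (by rcases hs with rfl | rfl <;> decide) hy hsteep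
    have hneg_two := hpair _ ![1, -2, -2 * s] (by rcases hs with rfl | rfl <;> decide) hshallow
    have htwo_two := hpair ![1, -1, 0] ![2, 2, -s] (by rcases hs with rfl | rfl <;> decide) hxy
    have htwo_neg_two := hthird _ _ ![2, -1, 2 * s] (by rcases hs with rfl | rfl <;> decide)
      (by rcases hs with rfl | rfl <;> decide) hneg_two htwo_two
    have hdiag := hpair _ ![1, 0, -s] (by rcases hs with rfl | rfl <;> decide) htwo_neg_two
    exact hthird ![0, 1, 0] _ ![1, 0, s] (by rcases hs with rfl | rfl <;> decide)
      (by rcases hs with rfl | rfl <;> decide) hy hdiag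
  · have hyz := hpair ![1, 0, 0] ![0, 1, -s] (by rcases hs with rfl | rfl <;> decide) hg
    have hsum : g ![1, 1, 0] := hthird _ _ _ (by decide) (by decide) hz hxy
    have hoct := hpair ![1, 1, 0] ![1, -1, -s] (by rcases hs with rfl | rfl <;> decide) hsum
    have htwo_one := hthird _ _ ![2, 1, s] (by rcases hs with rfl | rfl <;> decide)
      (by rcases hs with rfl | rfl <;> decide) hyz hoct
    have hsteep := hpair _ ![1, 0, -2 * s] (by rcases hs with rfl | rfl <;> decide) htwo_one
    have hshallow := hthird ![0, 1, 0] _ ![2, 0, s] (by rcases hs with rfl | rfl <;> decide)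
      (by rcases hs with rfl | rfl <;> decide) hy hsteep
    have hone_two := hpair _ ![1, 1, -2 * s] (by rcases hs with rfl | rfl <;> decide) hshallow
    have hones := hthird ![1, -1, 0] _ ![1, 1, s] (by rcases hs with rfl | rfl <;> decide)
      (by rcases hs with rfl | rfl <;> decide) hxy hone_two
    have hdiag := hpair _ ![1, 0, -s] (by rcases hs with rfl | rfl <;> decide) hones
    exact hthird ![0, 1, 0] _ ![1, 0, s] (by rcases hs with rfl | rfl <;> decide)
      (by rcases hs with rfl | rfl <;> decide) hy hdiag

end Colouring

/-- The Kochen–Specker contradiction in dimension three. -/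
theorem IsBinaryValuation.single_zero_ne_one {f : Matrix (Fin 3) (Fin 3) ℂ → ℝ}
    (hf : IsBinaryValuation f) : f (single 0 0 1) ≠ 1 := by
  intro h
  have hstar := rayProj_conjTranspose
  have hsq := rayProj_mul_self
  have hone : f 1 = 1 := by
    have hadd := hf.additive (single 0 0 1) (1 - single 0 0 1) (by simp) (by simp) (by simp)
      (by simp [mul_sub, sub_mul]) (by simp [mul_sub])
    rw [add_sub_cancel, h] at hadd
    rcases hf.binary 1 (by simp) (by simp) with h1 | h1
    · rcases hf.binary (1 - single 0 0 1) (by simp) (by simp [mul_sub, sub_mul]) with h2 | h2 <;>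
        linarith
    · exact h1
  have hpair (u v : Fin 3 → ℤ) (huv : u ⬝ᵥ v = 0) (hu : f (rayProj u) = 1) :
      ¬ f (rayProj v) = 1 := by
    have := hf.add_le_one (hstar u) (hsq u) (hstar v) (hsq v) (rayProj_mul_of_orthogonal huv)
    intro hv
    linarith
  have hbasis (b : Fin 3 → Fin 3 → ℤ) (h0 : ∀ k, b k ⬝ᵥ b k ≠ 0)
      (ho : ∀ k l, k ≠ l → b k ⬝ᵥ b l = 0) : ∃ k, f (rayProj (b k)) = 1 := by
    by_contra! hne
    have hz (k) : f (rayProj (b k)) = 0 := (hf.binary _ (hstar _) (hsq _)).resolve_right (hne k)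
    have h01 := rayProj_mul_of_orthogonal (ho 0 1 (by decide))
    have hsum := sum_rayProj_eq_one h0 ho
    rw [Fin.sum_univ_three] at hsum
    rw [← hsum, hf.additive _ _ (by simp [hstar])
      (isIdempotent_add_of_mul_eq_zero (hstar _) (hsq _) (hstar _) (hsq _) h01) (hstar _) (hsq _)
      (by simp [add_mul, rayProj_mul_of_orthogonal (ho 0 2 (by decide)),
        rayProj_mul_of_orthogonal (ho 1 2 (by decide))]),
      hf.additive _ _ (hstar _) (hsq _) (hstar _) (hsq _) h01] at hone
    simp [hz] at hone
  rw [← rayProj_single_zero] at h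
  have hforce {s : ℤ} (hs : s = 1 ∨ s = -1) :=
    ray_colouring_forces (g := fun v => f (rayProj v) = 1) hpair hbasis h hs
  exact hpair ![1, 0, 1] ![1, 0, -1] (by decide) (hforce (.inl rfl)) (hforce (.inr rfl))

/-- No global binary valuation, Kochen–Specker-type consequence of
Gleason's theorem: for `n ≥ 3` there is no `{0,1}`-valued function on the orthogonal
projections of `ℂ^n` with `f(1) = 1` that is additive on orthogonal pairs of projections;
a Global Binary Valuation of the graph of powers satisfying the additivity condition of an
Intensive State of Affairs is impossible. -/
theorem no_global_binary_valuation (n : ℕ) (hn : 3 ≤ n) :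
    ¬ ∃ f : Matrix (Fin n) (Fin n) ℂ → ℝ,
      (∀ P : Matrix (Fin n) (Fin n) ℂ, Pᴴ = P → P * P = P → f P = 0 ∨ f P = 1) ∧
      f (1 : Matrix (Fin n) (Fin n) ℂ) = 1 ∧
      (∀ P Q : Matrix (Fin n) (Fin n) ℂ, Pᴴ = P → P * P = P →
        Qᴴ = Q → Q * Q = Q → P * Q = 0 → f (P + Q) = f P + f Q) := by
  rintro ⟨f, hbin, h1, hadd⟩
  have hf : IsBinaryValuation f := ⟨hbin, hadd⟩
  obtain ⟨i, hi⟩ := hf.exists_single_eq_one h1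
  obtain ⟨σ, hσ, hσ0⟩ : ∃ σ : Fin 3 → Fin n, Function.Injective σ ∧ σ 0 = i := by
    refine ⟨Equiv.swap (Fin.castLE hn 0) i ∘ Fin.castLE hn,
      (Equiv.injective _).comp (Fin.castLE_injective hn), ?_⟩
    simp only [Function.comp_apply, Equiv.swap_apply_left]
  let E : Matrix (Fin n) (Fin 3) ℂ := (1 : Matrix (Fin n) (Fin n) ℂ).submatrix id σ
  have hE : Eᴴ * E = 1 := by
    simp only [E, conjTranspose_submatrix, conjTranspose_one]
    rw [← submatrix_mul _ _ _ _ _ Function.bijective_id, mul_one, submatrix_one σ hσ]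
  refine (hf.comp_isometry hE).single_zero_ne_one ?_
  have : E * single (0 : Fin 3) (0 : Fin 3) (1 : ℂ) * Eᴴ = single i i 1 := by
    ext a b
    simp [E, mul_apply, single, one_apply, hσ0, eq_comm, Fin.sum_univ_three, and_comm]
    by_cases ha : i = a <;> by_cases hb : i = b <;> grind
  simpa only [this] using hi
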